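/- Let R be a constructor TRS compatible with an exponential path order ≻epo* (i.e., l ≻epo* r for every rule l → r ∈ R, for some admissible precedence and safe mapping). Then there exists k ∈ ℕ such that the innermost runtime complexity of R is bounded by an exponential function: rc^i_R(n) ∈ 2^{O(n^k)}, i.e., there are c1, c2 with rc^i_R(n) ≤ 2^{c1 · n^{c2}} for all n. -/

import Mathlib

set_option maxHeartbeats 1000000

/-- First-order terms over a signature `F`, with variables drawn from `ℕ`. -/
inductive Tm (F : Type) : Type
  | var : ℕ → Tm F
  | fn  : F → List (Tm F) → Tm F

instance {F : Type} : Inhabited (Tm F) := ⟨Tm.var 0⟩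

/-- The size `|t|` of a term. -/
def Tm.size {F} : Tm F → ℕ
  | .var _ => 1
  | .fn _ ts => 1 + (ts.attach.map fun t => t.1.size).sum
decreasing_by have := List.sizeOf_lt_of_mem t.2; simp_wf; omega

/-- The depth of a term (variables and constants have depth 0). -/
def Tm.depth {F} : Tm F → ℕ
  | .var _ => 0
  | .fn _ [] => 0
  | .fn f (t :: ts) => max (t.depth + 1) (Tm.fn f ts).depth

/-- A (quasi-)precedence: a preorder `le` (i.e. `f ≿ g`) on the signature whose
strict part `≻` is well-founded. -/
structure Precedence (F : Type) where
  le : F → F → Prop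
  refl : ∀ f, le f f
  trans : ∀ {f g h}, le f g → le g h → le f h
  wf : WellFounded (fun g f => le f g ∧ ¬ le g f)

/-- The strict part `f ≻ g` of a precedence. -/
def Precedence.strict {F} (P : Precedence F) (f g : F) : Prop := P.le f g ∧ ¬ P.le g f

/-- The equivalence part `f ∼ g` of a precedence. -/
def Precedence.equiv {F} (P : Precedence F) (f g : F) : Prop := P.le f g ∧ P.le g f

/-- Constructor terms: terms built from constructors and variables only. -/
inductive IsCtorTerm {F} (D : F → Bool) : Tm F → Prop
  | var (v) : IsCtorTerm D (.var v)
  | fn {f : F} {ts : List (Tm F)} :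
      D f = false → (∀ t ∈ ts, IsCtorTerm D t) → IsCtorTerm D (.fn f ts)

/-- Basic terms: a defined root symbol applied to constructor terms. -/
def Basic {F} (D : F → Bool) (t : Tm F) : Prop :=
  ∃ f ts, t = Tm.fn f ts ∧ D f = true ∧ ∀ s ∈ ts, IsCtorTerm D s

/-- An admissible precedence: every defined symbol is strictly above every
constructor. -/
def Admissible {F} (P : Precedence F) (D : F → Bool) : Prop :=
  ∀ f c, D f = true → D c = false → P.strict f c

/-- A safe mapping is represented by `nrm : F → ℕ`: the first `nrm f` argument
positions of `f` are the normal ones, the remaining positions are the safe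
ones.  For constructors all argument positions must be safe. -/
def CtorsAllSafe {F} (D : F → Bool) (nrm : F → ℕ) : Prop :=
  ∀ c, D c = false → nrm c = 0

/-- The equivalence `s ≈s t`: equal terms, or equivalent root symbols with the
same safe/normal separation and pointwise `≈s`-equivalent arguments. -/
inductive SEq {F} (P : Precedence F) (nrm : F → ℕ) : Tm F → Tm F → Prop
  | refl (t) : SEq P nrm t t
  | fn {f g : F} {ss ts : List (Tm F)} :
      P.equiv f g → nrm f = nrm g → ss.length = ts.length →
      (∀ i, i < ss.length → SEq P nrm (ss.getD i default) (ts.getD i default)) →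
      SEq P nrm (.fn f ss) (.fn g ts)

/-- `s` is a strict superterm of `t` modulo `≈s`. -/
inductive SSupS {F} (P : Precedence F) (nrm : F → ℕ) : Tm F → Tm F → Prop
  | here {f : F} {ss : List (Tm F)} {s t : Tm F} :
      s ∈ ss → SEq P nrm s t → SSupS P nrm (.fn f ss) t
  | there {f : F} {ss : List (Tm F)} {s t : Tm F} :
      s ∈ ss → SSupS P nrm s t → SSupS P nrm (.fn f ss) t

mutual
/-- The auxiliary order `s ⊐ t` (Definition 4.1): descend through an argument,
which must be at a normal position whenever the root symbol is defined. -/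
inductive SubEpo {F} (P : Precedence F) (D : F → Bool) (nrm : F → ℕ) :
    Tm F → Tm F → Prop
  | intro {f : F} {ss : List (Tm F)} {t : Tm F} {i : ℕ} :
      i < ss.length → (D f = true → i < nrm f) →
      SubEpoEq P D nrm (ss.getD i default) t →
      SubEpo P D nrm (.fn f ss) t

/-- `⊐ ∪ ≈s`. -/
inductive SubEpoEq {F} (P : Precedence F) (D : F → Bool) (nrm : F → ℕ) :
    Tm F → Tm F → Prop
  | sub {s t} : SubEpo P D nrm s t → SubEpoEq P D nrm s t
  | eq {s t} : SEq P nrm s t → SubEpoEq P D nrm s t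
end

mutual
/-- The exponential path order `s ≻epo* t` (Definition 4.2), w.r.t. a
precedence `P`, defined symbols `D` and safe mapping `nrm` (the first `nrm f`
argument positions of `f` are its normal positions). -/
inductive EpoStar {F} (P : Precedence F) (D : F → Bool) (nrm : F → ℕ) :
    Tm F → Tm F → Prop
  /- (1) `sᵢ (≻epo* ∪ ≈s) t` for some argument `sᵢ` -/
  | arg {f : F} {ss : List (Tm F)} {t : Tm F} {i : ℕ} :
      i < ss.length →
      EpoStarEq P D nrm (ss.getD i default) t →
      EpoStar P D nrm (.fn f ss) t
  /- (2) `t = g(t₁,…,t_k;t_{k+1},…,t_{k+n})`, `f ≻ g`, `s ⊐ t_j` for normal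
     positions `j` and `s ≻epo* t_j` for safe positions `j` -/
  | prec {f g : F} {ss ts : List (Tm F)} :
      P.strict f g →
      (∀ j, j < nrm g → j < ts.length → SubEpo P D nrm (.fn f ss) (ts.getD j default)) →
      (∀ j, nrm g ≤ j → j < ts.length → EpoStar P D nrm (.fn f ss) (ts.getD j default)) →
      EpoStar P D nrm (.fn f ss) (.fn g ts)
  /- (3) `t = g(t₁,…,t_k;t_{k+1},…,t_{k+n})`, `f ∼ g`, a lexicographic descent
     at some normal position `i ≤ min(l,k)`, and `s ≻epo* t_j` for safe `j` -/
  | equiv {f g : F} {ss ts : List (Tm F)} {i : ℕ} :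
      P.equiv f g → i < nrm f → i < nrm g → i < ss.length → i < ts.length →
      (∀ i', i' < i → SEq P nrm (ss.getD i' default) (ts.getD i' default)) →
      SubEpo P D nrm (ss.getD i default) (ts.getD i default) →
      (∀ j, i < j → j < nrm g → j < ts.length → SubEpo P D nrm (.fn f ss) (ts.getD j default)) →
      (∀ j, nrm g ≤ j → j < ts.length → EpoStar P D nrm (.fn f ss) (ts.getD j default)) →
      EpoStar P D nrm (.fn f ss) (.fn g ts)

/-- `≻epo* ∪ ≈s`. -/
inductive EpoStarEq {F} (P : Precedence F) (D : F → Bool) (nrm : F → ℕ) :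
    Tm F → Tm F → Prop
  | epo {s t} : EpoStar P D nrm s t → EpoStarEq P D nrm s t
  | eq {s t} : SEq P nrm s t → EpoStarEq P D nrm s t
end

/-- Application of a substitution `σ : V → T(F,V)` to a term. -/
def subst {F} (σ : ℕ → Tm F) : Tm F → Tm F
  | .var v => σ v
  | .fn f ts => .fn f (ts.attach.map fun t => subst σ t.1)
decreasing_by have := List.sizeOf_lt_of_mem t.2; simp_wf; omega

/-- The variable `v` occurs in the term. -/
inductive VarIn {F} (v : ℕ) : Tm F → Prop
  | var : VarIn v (.var v)
  | fn {f : F} {ts : List (Tm F)} {t : Tm F} : t ∈ ts → VarIn v t → VarIn v (.fn f ts)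

/-- A term rewrite system: left-hand sides are not variables and all variables
of a right-hand side occur in the corresponding left-hand side. -/
def IsTRS {F} (R : Set (Tm F × Tm F)) : Prop :=
  ∀ lr ∈ R, (∀ v, lr.1 ≠ Tm.var v) ∧ (∀ v, VarIn v lr.2 → VarIn v lr.1)

/-- A constructor TRS: all left-hand sides are basic terms. -/
def ConstructorTRS {F} (D : F → Bool) (R : Set (Tm F × Tm F)) : Prop :=
  ∀ lr ∈ R, Basic D lr.1

/-- The rewrite relation `→_R` induced by `R`. -/
inductive Rew {F} (R : Set (Tm F × Tm F)) : Tm F → Tm F → Prop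
  | root {l r : Tm F} {σ : ℕ → Tm F} :
      (l, r) ∈ R → Rew R (subst σ l) (subst σ r)
  | congr {f : F} {pre post : List (Tm F)} {s t : Tm F} :
      Rew R s t → Rew R (.fn f (pre ++ s :: post)) (.fn f (pre ++ t :: post))

/-- `t` is an `R`-normal form. -/
def NFo {F} (R : Set (Tm F × Tm F)) (t : Tm F) : Prop := ∀ u, ¬ Rew R t u

/-- The innermost rewrite relation `i→_R`: contracted redexes have all their
proper subterms in normal form. -/
inductive IRew {F} (R : Set (Tm F × Tm F)) : Tm F → Tm F → Prop
  | root {l r : Tm F} {σ : ℕ → Tm F} :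
      (l, r) ∈ R →
      (∀ f us, subst σ l = Tm.fn f us → ∀ u ∈ us, NFo R u) →
      IRew R (subst σ l) (subst σ r)
  | congr {f : F} {pre post : List (Tm F)} {s t : Tm F} :
      IRew R s t → IRew R (.fn f (pre ++ s :: post)) (.fn f (pre ++ t :: post))

/-- `R` is completely defined: no defined symbol occurs in any normal form. -/
def CompletelyDefined {F} (D : F → Bool) (R : Set (Tm F × Tm F)) : Prop :=
  ∀ t, NFo R t → IsCtorTerm D t

/-- `Steps r n s t`: a derivation of length `n` from `s` to `t`. -/
def Steps {α} (r : α → α → Prop) : ℕ → α → α → Prop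
  | 0, s, t => s = t
  | n + 1, s, t => ∃ u, r s u ∧ Steps r n u t

/-- The innermost runtime complexity `rc^i_R(n)`: the supremum (in `ℕ∞`) of
the lengths of innermost derivations starting from basic terms of size at
most `n`. -/
noncomputable def rcI {F} (D : F → Bool) (R : Set (Tm F × Tm F)) (n : ℕ) : ℕ∞ :=
  sSup {m : ℕ∞ | ∃ (k : ℕ) (t u : Tm F),
    m = (k : ℕ∞) ∧ Basic D t ∧ t.size ≤ n ∧ Steps (IRew R) k t u}

/-- The set `Tn`: constructor terms, and terms whose normal arguments are
constructor terms and whose safe arguments are again in `Tn`. -/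
inductive TnSet {F} (D : F → Bool) (nrm : F → ℕ) : Tm F → Prop
  | ctor {t : Tm F} : IsCtorTerm D t → TnSet D nrm t
  | fn {f : F} {ts : List (Tm F)} :
      (∀ i, i < nrm f → i < ts.length → IsCtorTerm D (ts.getD i default)) →
      (∀ i, nrm f ≤ i → i < ts.length → TnSet D nrm (ts.getD i default)) →
      TnSet D nrm (.fn f ts)

/-- Structural induction on terms. -/
theorem Tm.induct {F} {motive : Tm F → Prop} (hvar : ∀ v, motive (.var v))
    (hfn : ∀ f ts, (∀ t ∈ ts, motive t) → motive (.fn f ts)) : ∀ t, motive t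
  | .var v => hvar v
  | .fn f ts => hfn f ts fun t _ => Tm.induct hvar hfn t
decreasing_by
  rename_i h
  have := List.sizeOf_lt_of_mem h
  simp_wf
  omega

theorem subst_fn {F} (σ : ℕ → Tm F) (f : F) (ts : List (Tm F)) :
    subst σ (.fn f ts) = .fn f (ts.map (subst σ)) := by
  simp [subst]

theorem subst_var {F} (σ : ℕ → Tm F) (v : ℕ) : subst σ (.var v) = σ v := by
  simp [subst]

theorem Tm.size_fn {F} (f : F) (ts : List (Tm F)) :
    (Tm.fn f ts).size = 1 + (ts.map Tm.size).sum := by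
  simp [Tm.size]

theorem Tm.size_pos {F} (t : Tm F) : 0 < t.size := by
  cases t <;> simp [Tm.size]

theorem List.getD_mem_of_lt {α} {l : List α} {i : ℕ} (h : i < l.length) (d : α) :
    l.getD i d ∈ l := by
  rw [List.getD_eq_getElem _ _ h]
  exact List.getElem_mem h

theorem List.getD_map_of_lt {α β} (g : α → β) {l : List α} {i : ℕ} (h : i < l.length)
    (d : α) (e : β) : (l.map g).getD i e = g (l.getD i d) := by
  rw [List.getD_eq_getElem _ _ h, List.getD_eq_getElem _ _ (by simpa using h), List.getElem_map]

theorem List.sum_map_eq_sum_range {α} (g : α → ℕ) (d : α) (l : List α) :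
    (l.map g).sum = ∑ i ∈ Finset.range l.length, g (l.getD i d) := by
  induction l with
  | nil => simp
  | cons a l ih => simp [Finset.sum_range_succ', ih, add_comm]

theorem List.getD_append_cons_of_ne {α} {pre post : List α} {s t : α} {j : ℕ}
    (h : j ≠ pre.length) (d : α) :
    (pre ++ t :: post).getD j d = (pre ++ s :: post).getD j d := by
  rcases lt_or_gt_of_ne h with h | h
  · rw [List.getD_append _ _ _ _ h, List.getD_append _ _ _ _ h]
  · rw [List.getD_append_right _ _ _ _ h.le, List.getD_append_right _ _ _ _ h.le]
    obtain ⟨m, hm⟩ : ∃ m, j - pre.length = m + 1 := ⟨j - pre.length - 1, by omega⟩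
    simp [hm]

theorem List.getD_append_cons_self {α} (pre post : List α) (t d : α) :
    (pre ++ t :: post).getD pre.length d = t := by
  rw [List.getD_append_right _ _ _ _ le_rfl]
  simp

/-- The size of a term in which subterms with a defined root count as atoms. -/
def Tm.weight {F} (D : F → Bool) : Tm F → ℕ
  | .var _ => 1
  | .fn f ts => if D f then 1 else 1 + (ts.attach.map fun t => t.1.weight D).sum
decreasing_by have := List.sizeOf_lt_of_mem t.2; simp_wf; omega

theorem Tm.weight_fn {F} (D : F → Bool) (f : F) (ts : List (Tm F)) :
    (Tm.fn f ts).weight D = if D f then 1 else 1 + (ts.map (Tm.weight D)).sum := by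
  simp [Tm.weight]

theorem Tm.weight_le_size {F} (D : F → Bool) (t : Tm F) : t.weight D ≤ t.size := by
  induction t using Tm.induct with
  | hvar v => simp [Tm.weight, Tm.size]
  | hfn f ts ih =>
    rw [Tm.weight_fn, Tm.size_fn]
    have := List.sum_le_sum ih
    split <;> omega

theorem Tm.weight_lt_of_mem {F} {D : F → Bool} {f : F} {ts : List (Tm F)} {t : Tm F}
    (hf : D f = false) (ht : t ∈ ts) : t.weight D < (Tm.fn f ts).weight D := by
  have := List.single_le_sum (l := ts.map (Tm.weight D)) (by simp) _ (List.mem_map_of_mem ht)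
  simp only [Tm.weight_fn, hf]
  simp
  omega

theorem Tm.size_lt_of_mem {F} {f : F} {ts : List (Tm F)} {t : Tm F}
    (ht : t ∈ ts) : t.size < (Tm.fn f ts).size := by
  have := List.single_le_sum (l := ts.map Tm.size) (by simp) _ (List.mem_map_of_mem ht)
  rw [Tm.size_fn]
  omega

section Order

variable {F : Type} {P : Precedence F} {D : F → Bool} {nrm : F → ℕ}

theorem Precedence.equiv.defined_eq {f g : F} (h : P.equiv f g) (hadm : Admissible P D) :
    D f = D g := by
  cases hf : D f <;> cases hg : D g <;> try rfl
  · exact absurd h.1 (hadm g f hg hf).2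
  · exact absurd h.2 (hadm f g hf hg).2

theorem Precedence.strict.defined_eq_false {f g : F} (h : P.strict f g) (hadm : Admissible P D)
    (hf : D f = false) : D g = false := by
  by_contra hg
  exact h.2 (hadm g f (by simpa using hg) hf).1

theorem SEq.isCtorTerm {s t : Tm F} (hadm : Admissible P D) (h : SEq P nrm s t)
    (hs : IsCtorTerm D s) : IsCtorTerm D t := by
  induction h with
  | refl t => exact hs
  | fn hfg _ hlen _ ih =>
    cases hs with
    | fn hf hss =>
      refine .fn (hfg.defined_eq hadm ▸ hf) fun t ht => ?_
      obtain ⟨i, hi, rfl⟩ := List.getElem_of_mem ht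
      have := ih i (by omega) (hss _ (List.getD_mem_of_lt (by omega) _))
      rwa [List.getD_eq_getElem _ _ hi] at this

theorem SEq.weight_subst {s t : Tm F} (hadm : Admissible P D) (h : SEq P nrm s t)
    (σ : ℕ → Tm F) : (subst σ s).weight D = (subst σ t).weight D := by
  induction h with
  | refl t => rfl
  | @fn f g ss ts hfg _ hlen _ ih =>
    have : (ss.map (subst σ)).map (Tm.weight D) = (ts.map (subst σ)).map (Tm.weight D) := by
      refine List.ext_getElem (by simpa using hlen) fun i h₁ h₂ => ?_
      simp only [List.length_map] at h₁ h₂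
      have := ih i h₁
      rw [List.getD_eq_getElem _ _ h₁, List.getD_eq_getElem _ _ h₂] at this
      simpa using this
    rw [subst_fn, subst_fn, Tm.weight_fn, Tm.weight_fn, this, hfg.defined_eq hadm]

theorem SubEpo.isCtorTerm_and_weight_lt {s t : Tm F} (hadm : Admissible P D)
    (h : SubEpo P D nrm s t) (σ : ℕ → Tm F) (hs : IsCtorTerm D s) :
    IsCtorTerm D t ∧ (subst σ t).weight D < (subst σ s).weight D := by
  refine SubEpo.rec
    (motive_1 := fun s t _ => IsCtorTerm D s →
      IsCtorTerm D t ∧ (subst σ t).weight D < (subst σ s).weight D)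
    (motive_2 := fun s t _ => IsCtorTerm D s →
      IsCtorTerm D t ∧ (subst σ t).weight D ≤ (subst σ s).weight D)
    ?_ ?_ ?_ h hs
  · intro f ss t i hi _ _ ih hs
    cases hs with
    | fn hf hss =>
      have hmem := List.getD_mem_of_lt hi (default : Tm F)
      obtain ⟨h₁, h₂⟩ := ih (hss _ hmem)
      refine ⟨h₁, h₂.trans_lt ?_⟩
      rw [subst_fn σ f]
      exact Tm.weight_lt_of_mem hf (List.mem_map_of_mem hmem)
  · intro s t _ ih hs
    exact ⟨(ih hs).1, (ih hs).2.le⟩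
  · intro s t h hs
    exact ⟨h.isCtorTerm hadm hs, (h.weight_subst hadm σ).ge⟩

/-- A term below a basic term in the auxiliary order is a constructor term bounded by one of the
normal arguments. -/
theorem SubEpo.exists_normal_arg {f : F} {ss : List (Tm F)} {t : Tm F} (hadm : Admissible P D)
    (h : SubEpo P D nrm (.fn f ss) t) (hf : D f = true) (hss : ∀ s ∈ ss, IsCtorTerm D s)
    (σ : ℕ → Tm F) :
    IsCtorTerm D t ∧ ∃ i < ss.length, i < nrm f ∧
      (subst σ t).weight D ≤ (subst σ (ss.getD i default)).weight D := by
  cases h with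
  | @intro _ _ _ i hi hn h =>
    have hc := hss _ (List.getD_mem_of_lt hi (default : Tm F))
    cases h with
    | sub h =>
      have := h.isCtorTerm_and_weight_lt hadm σ hc
      exact ⟨this.1, i, hi, hn hf, this.2.le⟩
    | eq h => exact ⟨h.isCtorTerm hadm hc, i, hi, hn hf, (h.weight_subst hadm σ).ge⟩

theorem EpoStar.isCtorTerm {s t : Tm F} (hadm : Admissible P D) (hsafe : CtorsAllSafe D nrm)
    (h : EpoStar P D nrm s t) (hs : IsCtorTerm D s) : IsCtorTerm D t := by
  refine EpoStar.rec
    (motive_1 := fun s t _ => IsCtorTerm D s → IsCtorTerm D t)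
    (motive_2 := fun s t _ => IsCtorTerm D s → IsCtorTerm D t)
    ?_ ?_ ?_ ?_ ?_ h hs
  · intro f ss t i hi _ ih hs
    cases hs with
    | fn hf hss => exact ih (hss _ (List.getD_mem_of_lt hi _))
  · intro f g ss ts hfg _ _ ih hs
    have hf : D f = false := by cases hs with | fn hf _ => exact hf
    have hg := hfg.defined_eq_false hadm hf
    refine .fn hg fun t ht => ?_
    obtain ⟨i, hi, rfl⟩ := List.getElem_of_mem ht
    have := ih i (by simp [hsafe g hg]) hi hs
    rwa [List.getD_eq_getElem _ _ hi] at this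
  · intro f g ss ts i _ hi _ _ _ _ _ _ _ _ hs
    have hf : D f = false := by cases hs with | fn hf _ => exact hf
    simp [hsafe f hf] at hi
  · intro s t _ ih
    exact ih
  · intro s t h hs
    exact h.isCtorTerm hadm hs

theorem EpoStarEq.isCtorTerm {s t : Tm F} (hadm : Admissible P D) (hsafe : CtorsAllSafe D nrm)
    (h : EpoStarEq P D nrm s t) (hs : IsCtorTerm D s) : IsCtorTerm D t := by
  cases h with
  | epo h => exact h.isCtorTerm hadm hsafe hs
  | eq h => exact h.isCtorTerm hadm hs

end Order

section NormalForms

variable {F : Type} {D : F → Bool} {R : Set (Tm F × Tm F)}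

theorem NFo.of_mem {f : F} {ts : List (Tm F)} {t : Tm F} (h : NFo R (.fn f ts)) (ht : t ∈ ts) :
    NFo R t := by
  intro u hu
  obtain ⟨pre, post, rfl⟩ := List.append_of_mem ht
  exact h _ (.congr hu)

theorem NFo.of_varIn {σ : ℕ → Tm F} {v : ℕ} {t : Tm F} (h : NFo R (subst σ t)) (hv : VarIn v t) :
    NFo R (σ v) := by
  induction hv with
  | var => rwa [subst_var] at h
  | fn ht _ ih =>
    rw [subst_fn] at h
    exact ih (h.of_mem (List.mem_map_of_mem ht))

theorem nfo_fn_of_ctor (hctor : ConstructorTRS D R) {c : F} (hc : D c = false)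
    {ts : List (Tm F)} (h : ∀ t ∈ ts, NFo R t) : NFo R (.fn c ts) := by
  intro u hu
  generalize hs : Tm.fn c ts = s at hu
  cases hu with
  | root hlr =>
    obtain ⟨f, ss, hl, hf, _⟩ := hctor _ hlr
    simp only at hl
    rw [hl, subst_fn] at hs
    injection hs with h₁ _
    rw [h₁, hf] at hc
    cases hc
  | congr hr =>
    injection hs with _ h₂
    exact h _ (by simp [h₂]) _ hr

theorem IsCtorTerm.nfo_subst (hctor : ConstructorTRS D R) {t : Tm F} (ht : IsCtorTerm D t)
    {σ : ℕ → Tm F} (hσ : ∀ v, VarIn v t → NFo R (σ v)) : NFo R (subst σ t) := by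
  induction ht with
  | var v => rw [subst_var]; exact hσ v .var
  | fn hf _ ih =>
    rw [subst_fn]
    refine nfo_fn_of_ctor hctor hf fun t ht => ?_
    obtain ⟨s, hs, rfl⟩ := List.mem_map.1 ht
    exact ih s hs fun v hv => hσ v (.fn hs hv)

theorem subst_eq_self (t : Tm F) : subst Tm.var t = t := by
  induction t using Tm.induct with
  | hvar v => rw [subst_var]
  | hfn f ts ih =>
    rw [subst_fn, List.map_congr_left (g := id) ih, List.map_id]

theorem nfo_var (hctor : ConstructorTRS D R) (v : ℕ) : NFo R (.var v) := by
  intro u hu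
  generalize hs : Tm.var v = s at hu
  cases hu with
  | root hlr =>
    obtain ⟨f, ss, hl, _⟩ := hctor _ hlr
    simp only at hl
    rw [hl, subst_fn] at hs
    cases hs
  | congr => cases hs

theorem IsCtorTerm.nfo (hctor : ConstructorTRS D R) {t : Tm F} (ht : IsCtorTerm D t) :
    NFo R t := by
  rw [← subst_eq_self t]
  exact ht.nfo_subst hctor fun v _ => nfo_var hctor v

theorem IRew.rew {s t : Tm F} (h : IRew R s t) : Rew R s t := by
  induction h with
  | root h _ => exact .root h
  | congr _ ih => exact .congr ih

end NormalForms

section Lexicographic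

/-- The number with leading part `r` and digits `d 0, …, d (k - 1)` in base `M + 1`. -/
def horner (M r : ℕ) (d : ℕ → ℕ) : ℕ → ℕ
  | 0 => r
  | k + 1 => horner M r d k * (M + 1) + d k

theorem horner_lt_of_lt {M r r' : ℕ} {d d' : ℕ → ℕ} {k m : ℕ} (hd : ∀ i, d i ≤ M)
    (hkm : k ≤ m) (h : horner M r d k < horner M r' d' k) :
    horner M r d m < horner M r' d' m := by
  induction m, hkm using Nat.le_induction with
  | base => exact h
  | succ m _ ih =>
    replace ih := Nat.mul_le_mul_right (M + 1) (Nat.succ_le_of_lt ih)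
    have := hd m
    rw [Nat.succ_mul] at ih
    simp only [horner]
    omega

theorem horner_congr {M r : ℕ} {d d' : ℕ → ℕ} {k : ℕ} (h : ∀ i < k, d i = d' i) :
    horner M r d k = horner M r d' k := by
  induction k with
  | zero => rfl
  | succ k ih => simp only [horner, ih fun i hi => h i (by omega), h k (by omega)]

theorem horner_lt_of_lex {M r : ℕ} {d d' : ℕ → ℕ} {i m : ℕ} (hd : ∀ i, d i ≤ M)
    (him : i < m) (heq : ∀ j < i, d j = d' j) (hlt : d i < d' i) :
    horner M r d m < horner M r d' m := by
  refine horner_lt_of_lt hd (Nat.succ_le_of_lt him) ?_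
  simp only [horner, horner_congr heq]
  omega

theorem horner_succ_le {M r : ℕ} {d : ℕ → ℕ} (hd : ∀ i, d i ≤ M) (k : ℕ) :
    horner M r d k + 1 ≤ (r + 1) * (M + 1) ^ k := by
  induction k with
  | zero => simp [horner]
  | succ k ih =>
    replace ih := Nat.mul_le_mul_right (M + 1) ih
    have := hd k
    rw [Nat.succ_mul (horner M r d k)] at ih
    simp only [horner, pow_succ, ← mul_assoc]
    omega

end Lexicographic

section Potential

variable {F : Type}

/-- The number of symbols strictly below `f`. -/
noncomputable def Precedence.rank (P : Precedence F) (f : F) : ℕ :=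
  Set.ncard {g | P.strict f g}

theorem Precedence.rank_lt [Fintype F] {P : Precedence F} {f g : F} (h : P.strict f g) :
    P.rank g < P.rank f := by
  refine Set.ncard_lt_ncard ⟨fun x hx => ?_, fun hsub => ?_⟩ (Set.toFinite _)
  · exact ⟨P.trans h.1 hx.1, fun hxf => h.2 (P.trans hx.1 hxf)⟩
  · exact (hsub h).2 (P.refl g)

theorem Precedence.rank_eq {P : Precedence F} {f g : F} (h : P.equiv f g) :
    P.rank f = P.rank g := by
  refine congrArg Set.ncard (Set.ext fun x => ⟨fun hx => ?_, fun hx => ?_⟩)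
  · exact ⟨P.trans h.2 hx.1, fun hxg => hx.2 (P.trans hxg h.2)⟩
  · exact ⟨P.trans h.1 hx.1, fun hxf => hx.2 (P.trans hxf h.1)⟩

theorem Precedence.rank_le [Fintype F] (P : Precedence F) (f : F) : P.rank f ≤ Fintype.card F := by
  rw [← Nat.card_eq_fintype_card]
  exact Set.ncard_le_card _

/-- The weights of the normal arguments, padded with zeros. -/
def normalWeight (D : F → Bool) (nrm : F → ℕ) (f : F) (ts : List (Tm F)) (i : ℕ) : ℕ :=
  if i < nrm f ∧ i < ts.length then (ts.getD i default).weight D else 0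

/-- The rank of a call: the rank of the function symbol followed by the weights of the normal
arguments, compared lexicographically. -/
noncomputable def callRank (P : Precedence F) (D : F → Bool) (nrm : F → ℕ) (A M : ℕ) (f : F)
    (ts : List (Tm F)) : ℕ :=
  horner M (P.rank f) (normalWeight D nrm f ts) A

/-- `Potential P D nrm R A M B t p`: all normal arguments of function calls to be evaluated in `t`
are normal forms of weight at most `M`, and `p` sums up `B ^ callRank` over these calls. -/
inductive Potential (P : Precedence F) (D : F → Bool) (nrm : F → ℕ) (R : Set (Tm F × Tm F))
    (A M B : ℕ) : Tm F → ℕ → Prop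
  | nf {t : Tm F} : NFo R t → Potential P D nrm R A M B t 0
  | fn {f : F} {ts : List (Tm F)} (p : ℕ → ℕ) :
      (∀ i, i < nrm f → i < ts.length →
        NFo R (ts.getD i default) ∧ (ts.getD i default).weight D ≤ M) →
      (∀ i, i < ts.length → Potential P D nrm R A M B (ts.getD i default) (p i)) →
      Potential P D nrm R A M B (.fn f ts)
        ((if D f then B ^ callRank P D nrm A M f ts else 0) + ∑ i ∈ Finset.range ts.length, p i)

variable {P : Precedence F} {D : F → Bool} {nrm : F → ℕ} {R : Set (Tm F × Tm F)} {A M B : ℕ}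

theorem normalWeight_le {f : F} {ts : List (Tm F)}
    (h : ∀ i, i < nrm f → i < ts.length → (ts.getD i default).weight D ≤ M) (i : ℕ) :
    normalWeight D nrm f ts i ≤ M := by
  unfold normalWeight
  split
  · rename_i hi
    exact h i hi.1 hi.2
  · exact Nat.zero_le _

/-- A function call all of whose normal arguments are normal forms of bounded weight has a small
potential if its safe arguments do and its call rank is below `m`. -/
theorem exists_potential_fn {g : F} {ts : List (Tm F)} {σ : ℕ → Tm F} {m : ℕ} (hB : 0 < B)
    (hn : ∀ j, j < nrm g → j < ts.length →
      NFo R (subst σ (ts.getD j default)) ∧ (subst σ (ts.getD j default)).weight D ≤ M)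
    (hs : ∀ j, nrm g ≤ j → j < ts.length → ∃ q,
      Potential P D nrm R A M B (subst σ (ts.getD j default)) q ∧
        q * B ≤ (ts.getD j default).size * B ^ m)
    (hm : callRank P D nrm A M g (ts.map (subst σ)) < m) :
    ∃ q, Potential P D nrm R A M B (subst σ (.fn g ts)) q ∧ q * B ≤ (Tm.fn g ts).size * B ^ m := by
  have hall : ∀ j, ∃ q, j < ts.length →
      Potential P D nrm R A M B (subst σ (ts.getD j default)) q ∧
        q * B ≤ (ts.getD j default).size * B ^ m := by
    intro j
    by_cases hj : j < ts.length
    · rcases lt_or_ge j (nrm g) with h | h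
      · exact ⟨0, fun _ => ⟨.nf (hn j h hj).1, by simp⟩⟩
      · obtain ⟨q, hq⟩ := hs j h hj
        exact ⟨q, fun _ => hq⟩
    · exact ⟨0, fun h => absurd h hj⟩
  choose q hq using hall
  rw [subst_fn]
  refine ⟨_, .fn q (fun j h₁ h₂ => ?_) (fun j h => ?_), ?_⟩
  · rw [List.length_map] at h₂
    rw [List.getD_map_of_lt _ h₂ default]
    exact hn j h₁ h₂
  · rw [List.length_map] at h
    rw [List.getD_map_of_lt _ h default]
    exact (hq j h).1
  · rw [List.length_map, Tm.size_fn, List.sum_map_eq_sum_range Tm.size default, add_mul, add_mul,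
      Finset.sum_mul, Finset.sum_mul, one_mul]
    refine add_le_add ?_ (Finset.sum_le_sum fun j hj => (hq j (Finset.mem_range.1 hj)).2)
    split
    · rw [← pow_succ]
      exact Nat.pow_le_pow_right hB hm
    · simp

theorem EpoStar.exists_potential [Fintype F] (hadm : Admissible P D) (hsafe : CtorsAllSafe D nrm)
    (hctor : ConstructorTRS D R) (hA : ∀ f, nrm f ≤ A) (hB : 0 < B) {f : F} {ss : List (Tm F)}
    (hf : D f = true) (hss : ∀ s ∈ ss, IsCtorTerm D s) {σ : ℕ → Tm F}
    (hM : ∀ i, i < nrm f → i < ss.length → (subst σ (ss.getD i default)).weight D ≤ M)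
    {t : Tm F} (h : EpoStar P D nrm (.fn f ss) t) (hσ : ∀ v, VarIn v t → NFo R (σ v)) :
    ∃ q, Potential P D nrm R A M B (subst σ t) q ∧
      q * B ≤ t.size * B ^ callRank P D nrm A M f (ss.map (subst σ)) := by
  have hsub : ∀ t, SubEpo P D nrm (.fn f ss) t → (∀ v, VarIn v t → NFo R (σ v)) →
      NFo R (subst σ t) ∧ (subst σ t).weight D ≤ M := by
    intro t ht hv
    obtain ⟨hc, i, hi, hin, hw⟩ := ht.exists_normal_arg hadm hf hss σ
    exact ⟨hc.nfo_subst hctor hv, hw.trans (hM i hin hi)⟩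
  generalize hs : Tm.fn f ss = s at h
  refine EpoStar.rec
    (motive_1 := fun s t _ => Tm.fn f ss = s → (∀ v, VarIn v t → NFo R (σ v)) →
      ∃ q, Potential P D nrm R A M B (subst σ t) q ∧
        q * B ≤ t.size * B ^ callRank P D nrm A M f (ss.map (subst σ)))
    (motive_2 := fun _ _ _ => True)
    ?_ ?_ ?_ ?_ ?_ h hs hσ
  · rintro f ss t i hi h - ⟨⟩ hv
    refine ⟨0, .nf ?_, by simp⟩
    exact (h.isCtorTerm hadm hsafe (hss _ (List.getD_mem_of_lt hi _))).nfo_subst hctor hv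
  · rintro f g ss ts hfg hn hs ih ⟨⟩ hv
    have hv' : ∀ j, j < ts.length → ∀ v, VarIn v (ts.getD j default) → NFo R (σ v) :=
      fun j hj v h => hv v (.fn (List.getD_mem_of_lt hj _) h)
    have hnorm := fun j h₁ h₂ => hsub _ (hn j h₁ h₂) (hv' j h₂)
    refine exists_potential_fn hB hnorm (fun j h₁ h₂ => ih j h₁ h₂ rfl (hv' j h₂)) ?_
    refine horner_lt_of_lt (k := 0) (normalWeight_le fun j h₁ h₂ => ?_) (Nat.zero_le _)
      (P.rank_lt hfg)
    rw [List.length_map] at h₂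
    rw [List.getD_map_of_lt _ h₂ default]
    exact (hnorm j h₁ h₂).2
  · rintro f g ss ts i hfg hif hig his hit heq hlt hn hs ih ⟨⟩ hv
    have hv' : ∀ j, j < ts.length → ∀ v, VarIn v (ts.getD j default) → NFo R (σ v) :=
      fun j hj v h => hv v (.fn (List.getD_mem_of_lt hj _) h)
    have hci := fun j (hj : j < ss.length) => hss _ (List.getD_mem_of_lt hj (default : Tm F))
    have hi := hlt.isCtorTerm_and_weight_lt hadm σ (hci i his)
    have hnorm : ∀ j, j < nrm g → j < ts.length →
        NFo R (subst σ (ts.getD j default)) ∧ (subst σ (ts.getD j default)).weight D ≤ M := by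
      intro j h₁ h₂
      rcases lt_trichotomy j i with h | rfl | h
      · have hj := hci j (h.trans his)
        refine ⟨((heq j h).isCtorTerm hadm hj).nfo_subst hctor (hv' j h₂), ?_⟩
        rw [← (heq j h).weight_subst hadm σ]
        exact hM j (h.trans hif) (h.trans his)
      · exact ⟨hi.1.nfo_subst hctor (hv' j h₂), hi.2.le.trans (hM j hif his)⟩
      · exact hsub _ (hn j h h₁ h₂) (hv' j h₂)
    refine exists_potential_fn hB hnorm (fun j h₁ h₂ => ih j h₁ h₂ rfl (hv' j h₂)) ?_
    unfold callRank
    rw [P.rank_eq hfg]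
    refine horner_lt_of_lex (i := i) (normalWeight_le fun j h₁ h₂ => ?_) (hif.trans_le (hA f))
      (fun j hj => ?_) ?_
    · rw [List.length_map] at h₂
      rw [List.getD_map_of_lt _ h₂ default]
      exact (hnorm j h₁ h₂).2
    · simp only [normalWeight, List.length_map, hj.trans hif, hj.trans hig, hj.trans his,
        hj.trans hit, and_self, if_true]
      rw [List.getD_map_of_lt _ (hj.trans hit) default, List.getD_map_of_lt _ (hj.trans his) default,
        (heq j hj).weight_subst hadm σ]
    · simp only [normalWeight, List.length_map, hif, hig, his, hit, and_self, if_true]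
      rw [List.getD_map_of_lt _ hit default, List.getD_map_of_lt _ his default]
      exact hi.2
  · intros
    trivial
  · intros
    trivial

theorem Potential.exists_lt_of_iRew [Fintype F] (hadm : Admissible P D) (hsafe : CtorsAllSafe D nrm)
    (hTRS : IsTRS R) (hctor : ConstructorTRS D R)
    (hcompat : ∀ lr ∈ R, EpoStar P D nrm lr.1 lr.2) (hA : ∀ f, nrm f ≤ A)
    (hB : ∀ lr ∈ R, lr.2.size < B) {s t : Tm F} (h : IRew R s t) {p : ℕ}
    (hp : Potential P D nrm R A M B s p) :
    ∃ q < p, Potential P D nrm R A M B t q := by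
  induction h generalizing p with
  | @root l r σ hlr hinner =>
    obtain ⟨f, ss, hl, hf, hss⟩ := hctor _ hlr
    simp only at hl
    subst hl
    have hBpos : 0 < B := (Nat.zero_le _).trans_lt (hB _ hlr)
    have hσ : ∀ v, VarIn v r → NFo R (σ v) := by
      intro v hv
      cases (hTRS _ hlr).2 v hv with
      | fn ht hv =>
        exact (hinner _ _ (subst_fn σ f ss) _ (List.mem_map_of_mem ht)).of_varIn hv
    have hred := Rew.root (σ := σ) hlr
    rw [subst_fn] at hp hred
    cases hp with
    | nf h => exact absurd hred (h _)
    | fn p hn _ =>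
      have hM : ∀ i, i < nrm f → i < ss.length →
          (subst σ (ss.getD i default)).weight D ≤ M := by
        intro i h₁ h₂
        have := (hn i h₁ (by simpa using h₂)).2
        rwa [List.getD_map_of_lt _ h₂ default] at this
      obtain ⟨q, hq, hle⟩ := (hcompat _ hlr).exists_potential hadm hsafe hctor hA hBpos hf hss hM hσ
      refine ⟨q, ?_, hq⟩
      rw [if_pos hf]
      refine Nat.lt_add_right _ (lt_of_mul_lt_mul_right (a := B) (hle.trans_lt ?_) (Nat.zero_le _))
      rw [mul_comm]
      exact Nat.mul_lt_mul_of_pos_left (hB _ hlr) (Nat.pow_pos hBpos)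
  | @congr f pre post s t hst ih =>
    cases hp with
    | nf h => exact absurd (Rew.congr hst.rew) (h _)
    | fn p hn hp =>
      have hlen : ∀ u : Tm F, (pre ++ u :: post).length = pre.length + (post.length + 1) := by simp
      have hi : pre.length < (pre ++ s :: post).length := by rw [hlen]; omega
      have hpi := hp _ hi
      have hsafe_pos : nrm f ≤ pre.length := by
        by_contra! hlt
        have := (hn _ hlt hi).1
        rw [List.getD_append_cons_self] at this
        exact this _ hst.rew
      rw [List.getD_append_cons_self] at hpi
      obtain ⟨q, hq, hpot⟩ := ih hpi
      have hrank : callRank P D nrm A M f (pre ++ t :: post) =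
          callRank P D nrm A M f (pre ++ s :: post) := by
        refine horner_congr fun j _ => ?_
        unfold normalWeight
        rw [hlen, hlen]
        split
        · rw [List.getD_append_cons_of_ne (s := s) (by omega)]
        · rfl
      refine ⟨_, ?_, .fn (Function.update p pre.length q) (fun j h₁ h₂ => ?_) (fun j h => ?_)⟩
      · rw [hrank, hlen, hlen]
        refine add_lt_add_right (Finset.sum_lt_sum (fun j _ => ?_) ⟨pre.length, ?_, ?_⟩) _
        · rcases eq_or_ne j pre.length with rfl | hj
          · simpa using hq.le
          · simp [hj]
        · simp
        · simpa using hq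
      · rw [List.getD_append_cons_of_ne (s := s) (by omega)]
        exact hn j h₁ (by rw [hlen] at *; exact h₂)
      · rcases eq_or_ne j pre.length with rfl | hj
        · simpa [List.getD_append_cons_self] using hpot
        · rw [List.getD_append_cons_of_ne (s := s) hj, Function.update_of_ne hj]
          exact hp j (by rw [hlen] at *; exact h)

theorem Potential.steps_le [Fintype F] (hadm : Admissible P D) (hsafe : CtorsAllSafe D nrm)
    (hTRS : IsTRS R) (hctor : ConstructorTRS D R)
    (hcompat : ∀ lr ∈ R, EpoStar P D nrm lr.1 lr.2) (hA : ∀ f, nrm f ≤ A)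
    (hB : ∀ lr ∈ R, lr.2.size < B) {k : ℕ} {s t : Tm F} (h : Steps (IRew R) k s t) {p : ℕ}
    (hp : Potential P D nrm R A M B s p) : k ≤ p := by
  induction k generalizing s p with
  | zero => exact Nat.zero_le _
  | succ k ih =>
    obtain ⟨u, hsu, hut⟩ := h
    obtain ⟨q, hq, hu⟩ := hp.exists_lt_of_iRew hadm hsafe hTRS hctor hcompat hA hB hsu
    exact (ih hut hu).trans_lt hq

end Potential

/-- Theorem 4.5 (soundness): a finite constructor TRS over a finite signature
that is compatible with an exponential path order `≻epo*` (for some admissible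
precedence and safe mapping) has innermost runtime complexity in `2^{O(n^k)}`:
there are `c1`, `c2` with `rc^i_R(n) ≤ 2^(c1 · n^c2)` for all `n`. -/
theorem epostar_soundness {F : Type} [Fintype F] (P : Precedence F)
    (D : F → Bool) (nrm : F → ℕ) (hadm : Admissible P D)
    (hsafe : CtorsAllSafe D nrm)
    (R : Set (Tm F × Tm F)) (hfin : R.Finite) (hTRS : IsTRS R)
    (hctor : ConstructorTRS D R)
    (hcompat : ∀ lr ∈ R, EpoStar P D nrm lr.1 lr.2) :
    ∃ c1 c2 : ℕ, ∀ n : ℕ, rcI D R n ≤ ((2 ^ (c1 * n ^ c2) : ℕ) : ℕ∞) := by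
  obtain ⟨A, hA⟩ : ∃ A, ∀ f, nrm f ≤ A :=
    ⟨Finset.univ.sup nrm, fun f => Finset.le_sup (Finset.mem_univ f)⟩
  obtain ⟨b, hb⟩ : ∃ b, ∀ lr ∈ R, lr.2.size < 2 ^ b := by
    obtain ⟨b, hb⟩ := (hfin.image fun lr => lr.2.size).bddAbove
    exact ⟨b, fun lr h => (hb (Set.mem_image_of_mem _ h)).trans_lt Nat.lt_two_pow_self⟩
  refine ⟨b * ((Fintype.card F + 1) * 2 ^ A), A, fun n => sSup_le ?_⟩
  rintro _ ⟨k, t, u, rfl, ⟨f, ts, rfl, hf, hts⟩, hsize, hsteps⟩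
  have hw : ∀ i, i < nrm f → i < ts.length → (ts.getD i default).weight D ≤ n := fun i _ hi =>
    ((Tm.weight_le_size D _).trans (Tm.size_lt_of_mem (List.getD_mem_of_lt hi _)).le).trans hsize
  have hnf := fun i (hi : i < ts.length) =>
    (hts _ (List.getD_mem_of_lt hi (default : Tm F))).nfo hctor
  have hpot : Potential P D nrm R A n (2 ^ b) (.fn f ts) _ :=
    .fn (fun _ => 0) (fun i h₁ h₂ => ⟨hnf i h₂, hw i h₁ h₂⟩) (fun i hi => .nf (hnf i hi))
  have hk := hpot.steps_le hadm hsafe hTRS hctor hcompat hA hb hsteps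
  rw [if_pos hf, Finset.sum_const_zero, add_zero, ← pow_mul] at hk
  refine Nat.cast_le.2 (hk.trans (Nat.pow_le_pow_right two_pos ?_))
  rw [mul_assoc, mul_assoc, ← mul_pow]
  refine Nat.mul_le_mul_left b ?_
  have hn : n + 1 ≤ 2 * n := by
    have := (Tm.fn f ts).size_pos
    omega
  calc callRank P D nrm A n f ts
      ≤ (P.rank f + 1) * (n + 1) ^ A := Nat.le_of_succ_le (horner_succ_le (normalWeight_le hw) A)
    _ ≤ (Fintype.card F + 1) * (2 * n) ^ A :=
      Nat.mul_le_mul (Nat.succ_le_succ (P.rank_le f)) (Nat.pow_le_pow_left hn A)
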